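/- arXiv:math/0302142 — 3 statements merged into one kernel-verified Lean document; each statement's English description precedes it below -/
import Mathlib

section
/- (Raising ladder relation for monic Jacobi polynomials.) For every n ≥ 1 and all real z, (z² − 1) Pₙ′(z) = [(n + rₙ)(z + 1) − rₙ(z − 1)] Pₙ(z) − 2 bₙ Rₙ P_{n−1}(z). -/
open MeasureTheory Polynomial

lemma jac_intble (α β : ℝ) (hα : 0 < α) (hβ : 0 < β) (f : ℝ[X]) :
    IntervalIntegrable (fun x : ℝ => f.eval x * ((1 - x) ^ α * (1 + x) ^ (β - 1)))
      volume (-1) 1 := by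
  have h1 : IntervalIntegrable (fun x : ℝ => x ^ (β - 1)) volume 0 2 :=
    intervalIntegral.intervalIntegrable_rpow' (by linarith)
  have h2 : IntervalIntegrable (fun x : ℝ => (1 + x) ^ (β - 1)) volume (-1) 1 := by
    have := h1.comp_add_left 1
    norm_num at this
    exact this
  have h3 : ContinuousOn (fun x : ℝ => f.eval x * (1 - x) ^ α) (Set.uIcc (-1) 1) := by
    apply Continuous.continuousOn
    apply f.continuous.mul
    exact (continuous_const.sub continuous_id).rpow_const (fun x => Or.inr hα.le)
  have := h2.continuousOn_mul h3
  refine this.congr ?_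
  intro x _
  simp only
  ring

/-- The linear functional of integration against `(1-x)^α (1+x)^(β-1)`. -/
noncomputable def jacM (α β : ℝ) (hα : 0 < α) (hβ : 0 < β) : ℝ[X] →ₗ[ℝ] ℝ where
  toFun f := ∫ x in (-1 : ℝ)..1, f.eval x * ((1 - x) ^ α * (1 + x) ^ (β - 1))
  map_add' f g := by
    rw [← intervalIntegral.integral_add (jac_intble α β hα hβ f) (jac_intble α β hα hβ g)]
    congr 1
    ext x
    rw [eval_add]
    ring
  map_smul' c f := by
    simp only [RingHom.id_apply, smul_eq_mul]
    rw [← intervalIntegral.integral_const_mul]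
    congr 1
    ext x
    rw [eval_smul, smul_eq_mul]
    ring

lemma jac_weight (β : ℝ) (hβ : 0 < β) (x : ℝ) (hx : -1 ≤ x) :
    (1 + x) ^ β = (1 + x) * (1 + x) ^ (β - 1) := by
  rcases hx.eq_or_lt with rfl | hx
  · norm_num
    exact Real.zero_rpow hβ.ne'
  · have h0 : 0 < 1 + x := by linarith
    rw [Real.rpow_sub_one h0.ne']
    field_simp

lemma jacM_L (α β : ℝ) (hα : 0 < α) (hβ : 0 < β) (f : ℝ[X]) :
    jacM α β hα hβ ((1 + X) * f)
      = ∫ x in (-1 : ℝ)..1, f.eval x * ((1 - x) ^ α * (1 + x) ^ β) := by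
  change (∫ x in (-1 : ℝ)..1, _) = _
  apply intervalIntegral.integral_congr
  intro x hx
  rw [Set.uIcc_of_le (by norm_num)] at hx
  simp only [eval_mul, eval_add, eval_one, eval_X]
  rw [jac_weight β hβ x hx.1]
  ring

lemma jacM_ibp (α β : ℝ) (hα : 0 < α) (hβ : 0 < β) (f : ℝ[X]) :
    jacM α β hα hβ ((1 - X) * (1 + X) * derivative f
      - C (α + 1) * (1 + X) * f + C β * (1 - X) * f) = 0 := by
  change (∫ x in (-1 : ℝ)..1, _) = _
  rw [intervalIntegral.integral_eq_sub_of_hasDerivAt_of_le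
    (f := fun x => f.eval x * ((1 - x) ^ (α + 1) * (1 + x) ^ β)) (by norm_num)]
  · have h1 : (0 : ℝ) ^ (α + 1) = 0 := Real.zero_rpow (by linarith)
    have h2 : (0 : ℝ) ^ β = 0 := Real.zero_rpow hβ.ne'
    norm_num [h1, h2]
  · apply Continuous.continuousOn
    refine f.continuous.mul (Continuous.mul ?_ ?_)
    · exact (continuous_const.sub continuous_id).rpow_const (fun x => Or.inr (by linarith))
    · exact (continuous_const.add continuous_id).rpow_const (fun x => Or.inr hβ.le)
  · intro x hx
    have hp : 0 < 1 + x := by linarith [hx.1]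
    have hm : 0 < 1 - x := by linarith [hx.2]
    have d1 : HasDerivAt (fun x : ℝ => (1 - x) ^ (α + 1)) (-1 * (α + 1) * (1 - x) ^ (α + 1 - 1)) x :=
      ((hasDerivAt_id x).const_sub 1).rpow_const (Or.inl hm.ne')
    have d2 : HasDerivAt (fun x : ℝ => (1 + x) ^ β) (1 * β * (1 + x) ^ (β - 1)) x :=
      ((hasDerivAt_id x).const_add 1).rpow_const (Or.inl hp.ne')
    have d := (f.hasDerivAt x).mul (d1.mul d2)
    refine d.congr_deriv ?_
    simp only [Pi.mul_apply]
    rw [add_sub_cancel_right, Real.rpow_add_one hm.ne', jac_weight β hβ x hx.1.le]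
    simp only [eval_mul, eval_add, eval_one, eval_X, eval_sub, eval_C]
    ring
  · exact jac_intble α β hα hβ _

lemma jac_pos (α β : ℝ) (hα : 0 < α) (hβ : 0 < β) (f : ℝ[X]) (hf : f ≠ 0) :
    0 < ∫ x in (-1 : ℝ)..1, (f.eval x) ^ 2 * ((1 - x) ^ α * (1 + x) ^ β) := by
  have hc : Continuous (fun x : ℝ => (f.eval x) ^ 2 * ((1 - x) ^ α * (1 + x) ^ β)) := by
    refine (f.continuous.pow 2).mul (Continuous.mul ?_ ?_)
    · exact (continuous_const.sub continuous_id).rpow_const (fun x => Or.inr hα.le)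
    · exact (continuous_const.add continuous_id).rpow_const (fun x => Or.inr hβ.le)
  have hinf : (Set.Ioo (-1 : ℝ) 1).Infinite := Set.Ioo_infinite (by norm_num)
  obtain ⟨c, hc1, hc2⟩ := hinf.exists_notMem_finset f.roots.toFinset
  apply intervalIntegral.integral_pos (by norm_num) hc.continuousOn
  · intro x hx
    have hp : 0 ≤ 1 + x := by linarith [hx.1]
    have hm : 0 ≤ 1 - x := by linarith [hx.2]
    positivity
  · refine ⟨c, ⟨hc1.1.le, hc1.2.le⟩, ?_⟩
    have hp : 0 < 1 + c := by linarith [hc1.1]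
    have hm : 0 < 1 - c := by linarith [hc1.2]
    have : f.eval c ≠ 0 := by
      intro h0
      apply hc2
      simp [hf, h0]
    positivity

lemma orth_low (L : ℝ[X] →ₗ[ℝ] ℝ) (P : ℕ → ℝ[X])
    (hmonic : ∀ n, (P n).Monic) (hdeg : ∀ n, (P n).natDegree = n)
    (horth : ∀ m n : ℕ, m ≠ n → L (P m * P n) = 0) (n : ℕ) :
    ∀ k, k ≤ n → ∀ q : ℝ[X], (∀ N, k ≤ N → q.coeff N = 0) → L (P n * q) = 0 := by
  intro k
  induction k with
  | zero =>
    intro _ q hq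
    have : q = 0 := by
      ext N
      simpa using hq N (Nat.zero_le _)
    simp [this]
  | succ k ih =>
    intro hk q hq
    have h1 : L (P n * (q - C (q.coeff k) * P k)) = 0 := by
      apply ih (by omega)
      intro N hN
      rw [coeff_sub, coeff_C_mul]
      rcases hN.eq_or_lt with rfl | hN
      · have : (P k).coeff k = 1 := by
          have := (hmonic k).coeff_natDegree
          rwa [hdeg] at this
        rw [this]
        ring
      · rw [hq N hN, coeff_eq_zero_of_natDegree_lt (p := P k) (by rw [hdeg]; exact hN)]
        ring
    have h2 : P n * (q - C (q.coeff k) * P k) = P n * q - q.coeff k • (P n * P k) := by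
      rw [smul_eq_C_mul]
      ring
    rw [h2, map_sub, map_smul, horth n k (by omega)] at h1
    simpa using h1

lemma orth_coeff (L : ℝ[X] →ₗ[ℝ] ℝ) (P : ℕ → ℝ[X])
    (hmonic : ∀ n, (P n).Monic) (hdeg : ∀ n, (P n).natDegree = n)
    (horth : ∀ m n : ℕ, m ≠ n → L (P m * P n) = 0) (n : ℕ)
    (q : ℝ[X]) (hq : ∀ N, n < N → q.coeff N = 0) :
    L (P n * q) = q.coeff n * L (P n * P n) := by
  have h1 : L (P n * (q - C (q.coeff n) * P n)) = 0 := by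
    apply orth_low L P hmonic hdeg horth n n le_rfl
    intro N hN
    rw [coeff_sub, coeff_C_mul]
    rcases hN.eq_or_lt with rfl | hN
    · have : (P n).coeff n = 1 := by
        have := (hmonic n).coeff_natDegree
        rwa [hdeg] at this
      rw [this]
      ring
    · rw [hq N hN, coeff_eq_zero_of_natDegree_lt (p := P n) (by rw [hdeg]; exact hN)]
      ring
  have h2 : P n * (q - C (q.coeff n) * P n) = P n * q - q.coeff n • (P n * P n) := by
    rw [smul_eq_C_mul]
    ring
  rw [h2, map_sub, map_smul, smul_eq_mul] at h1
  linarith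

lemma coeff_X_mul_deriv (p : ℝ[X]) (k : ℕ) :
    (X * derivative p).coeff k = k * p.coeff k := by
  cases k with
  | zero => simp
  | succ k =>
    rw [coeff_X_mul, coeff_derivative]
    push_cast
    ring

lemma jac_alg (α β : ℝ) (L M : ℝ[X] →ₗ[ℝ] ℝ)
    (hLM : ∀ f, M ((1 + X) * f) = L f)
    (hibp : ∀ f, M ((1 - X) * (1 + X) * derivative f
      - C (α + 1) * (1 + X) * f + C β * (1 - X) * f) = 0)
    (hpos : ∀ f, f ≠ 0 → 0 < L (f * f))
    (P : ℕ → ℝ[X])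
    (hmonic : ∀ n, (P n).Monic) (hdeg : ∀ n, (P n).natDegree = n)
    (horth : ∀ m n : ℕ, m ≠ n → L (P m * P n) = 0) (m : ℕ) (a b R r : ℝ)
    (hrec : X * P (m + 1) = P (m + 2) + C a * P (m + 1) + C b * P m)
    (hR : R * L (P (m + 1) * P (m + 1)) = β * M (P (m + 1) * P (m + 1)))
    (hr : r * L (P m * P m) = β * M (P (m + 1) * P m)) :
    (X ^ 2 - 1) * derivative (P (m + 1)) =
      (C ((m : ℝ) + 1) * X + C ((m : ℝ) + 1 + 2 * r)) * P (m + 1) - C (2 * b * R) * P m := by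
  have lead : ∀ n, (P n).coeff n = 1 := fun n => by
    have := (hmonic n).coeff_natDegree
    rwa [hdeg] at this
  have hi : ∀ n N, n < N → (P n).coeff N = 0 := fun n N hN =>
    coeff_eq_zero_of_natDegree_lt (by rw [hdeg]; exact hN)
  have oc := orth_coeff L P hmonic hdeg horth
  have star : ∀ f, 2 * β * M f = (α + β + 1) * L f - L ((1 - X) * derivative f) := by
    intro f
    have h1 := hibp f
    have h2 : (1 - X) * (1 + X) * derivative f
      - C (α + 1) * (1 + X) * f + C β * (1 - X) * f
      = (1 + X) * ((1 - X) * derivative f) - (α + β + 1) • ((1 + X) * f) + (2 * β) • f := by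
      simp only [smul_eq_C_mul, C_add, C_mul, C_1, C_ofNat]
      ring
    rw [h2, map_add, map_sub, map_smul, map_smul, hLM, hLM, smul_eq_mul, smul_eq_mul] at h1
    linarith
  have star2 : ∀ g, L ((X ^ 2 - 1) * derivative g) =
      (β - α) * L g - (α + β + 2) * L (X * g) := by
    intro g
    have h1 := star ((1 + X) * g)
    have h2 : (1 - X) * derivative ((1 + X) * g) =
      g - X * g - (X ^ 2 - 1) * derivative g := by
      simp only [derivative_mul, derivative_add, derivative_one, derivative_X]
      ring
    have h3 : (1 + X) * g = g + X * g := by ring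
    rw [h2, hLM, map_sub, map_sub, h3, map_add] at h1
    linarith
  set p := (P (m + 1)).coeff m with hp
  set H := L (P (m + 1) * P (m + 1)) with hH
  set K := L (P m * P m) with hK
  have Hpos : 0 < H := hpos _ (hmonic _).ne_zero
  have Kpos : 0 < K := hpos _ (hmonic _).ne_zero
  -- b
  have hb : b * K = H := by
    have h1 : L (P m * (X * P (m + 1))) = b * K := by
      have : P m * (X * P (m + 1)) =
          P m * P (m + 2) + a • (P m * P (m + 1)) + b • (P m * P m) := by
        rw [hrec]
        simp only [smul_eq_C_mul]
        ring
      rw [this, map_add, map_add, map_smul, map_smul, horth m (m + 2) (by omega),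
        horth m (m + 1) (by omega)]
      simp [hK]
    have h2 : L (P (m + 1) * (X * P m)) = (X * P m).coeff (m + 1) * H := by
      apply oc
      intro N hN
      obtain ⟨j, rfl⟩ : ∃ j, N = j + 1 := ⟨N - 1, by omega⟩
      rw [coeff_X_mul]
      exact hi _ _ (by omega)
    rw [coeff_X_mul, lead, one_mul] at h2
    rw [← h1, ← h2]
    congr 1
    ring
  -- R
  have hRv : 2 * R = 2 * (m : ℝ) + 3 + α + β := by
    have h1 := star (P (m + 1) * P (m + 1))
    have h2 : (1 - X) * derivative (P (m + 1) * P (m + 1)) =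
        (2 : ℝ) • (P (m + 1) * (derivative (P (m + 1)) - X * derivative (P (m + 1)))) := by
      simp only [derivative_mul, smul_eq_C_mul, C_ofNat]
      ring
    rw [h2, map_smul, oc (m + 1) (derivative (P (m + 1)) - X * derivative (P (m + 1)))] at h1
    · rw [coeff_sub, coeff_X_mul_deriv, coeff_derivative, hi (m + 1) (m + 1 + 1) (by omega),
        lead, ← hH] at h1
      push_cast at h1
      have h3 : 2 * R * H = (2 * (m : ℝ) + 3 + α + β) * H := by
        simp only [smul_eq_mul] at h1
        linear_combination 2 * hR + h1
      exact mul_right_cancel₀ Hpos.ne' h3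
    · intro N hN
      rw [coeff_sub, coeff_X_mul_deriv, coeff_derivative, hi (m + 1) (N + 1) (by omega),
        hi (m + 1) N hN]
      ring
  -- r
  have hrv : 2 * r = -((m : ℝ) + 1 + p) := by
    have h1 := star (P (m + 1) * P m)
    have h2 : (1 - X) * derivative (P (m + 1) * P m) =
        P m * (derivative (P (m + 1)) - X * derivative (P (m + 1))
          + C ((m : ℝ) + 1) * P (m + 1)) - ((m : ℝ) + 1) • (P m * P (m + 1))
        + P (m + 1) * (derivative (P m) - X * derivative (P m)) := by
      simp only [derivative_mul, smul_eq_C_mul]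
      ring
    rw [h2, map_add, map_sub, map_smul, horth m (m + 1) (by omega),
      horth (m + 1) m (by omega), oc m, oc (m + 1)] at h1
    · simp only [coeff_sub, coeff_add, coeff_C_mul, coeff_X_mul_deriv, coeff_derivative] at h1
      rw [hi m (m + 1 + 1) (by omega), hi m (m + 1) (by omega), lead, ← hp, ← hK] at h1
      simp only [smul_eq_mul] at h1
      have h3 : 2 * r * K = -((m : ℝ) + 1 + p) * K := by
        linear_combination 2 * hr + h1
      exact mul_right_cancel₀ Kpos.ne' h3
    · intro N hN
      rw [coeff_sub, coeff_X_mul_deriv, coeff_derivative, hi m (N + 1) (by omega),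
        hi m N (by omega)]
      ring
    · intro N hN
      simp only [coeff_sub, coeff_add, coeff_C_mul, coeff_X_mul_deriv, coeff_derivative]
      rw [hi (m + 1) (N + 1) (by omega)]
      rcases (Nat.succ_le_of_lt hN).eq_or_lt with h | h
      · rw [← h]
        push_cast
        ring
      · rw [hi (m + 1) N h]
        ring
  -- the difference
  rw [← sub_eq_zero]
  set D := (X ^ 2 - 1) * derivative (P (m + 1)) -
      ((C ((m : ℝ) + 1) * X + C ((m : ℝ) + 1 + 2 * r)) * P (m + 1) - C (2 * b * R) * P m) with hD
  have Dc : ∀ N, m < N → D.coeff N = 0 := by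
    intro N hN
    obtain ⟨k, rfl⟩ : ∃ k, N = k + 1 := ⟨N - 1, by omega⟩
    have e : D = X * (X * derivative (P (m + 1))) - derivative (P (m + 1))
      - C ((m : ℝ) + 1) * (X * P (m + 1)) - C ((m : ℝ) + 1 + 2 * r) * P (m + 1)
      + C (2 * b * R) * P m := by
      rw [hD]
      ring
    rw [e]
    simp only [coeff_sub, coeff_add, coeff_C_mul]
    rw [coeff_X_mul, coeff_X_mul_deriv, coeff_derivative, coeff_X_mul,
      hi (m + 1) (k + 1 + 1) (by omega), hi m (k + 1) hN]
    rcases (Nat.le_of_lt_succ hN).eq_or_lt with h | h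
    · rw [← h, lead, ← hp]
      linear_combination -hrv
    · rw [hi (m + 1) (k + 1) (by omega)]
      rcases (Nat.succ_le_of_lt h).eq_or_lt with h' | h'
      · rw [← h']
        push_cast
        ring
      · rw [hi (m + 1) k (by omega)]
        ring
  have LD : ∀ q : ℝ[X], (∀ N, m < N → q.coeff N = 0) → L (D * q) = 0 := by
    intro q hq
    have e : D * q = (X ^ 2 - 1) * derivative (P (m + 1) * q)
      - P (m + 1) * (X * (X * derivative q) - derivative q + C ((m : ℝ) + 1) * (X * q)
          + C ((m : ℝ) + 1 + 2 * r) * q)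
      + (2 * b * R) • (P m * q) := by
      rw [hD, smul_eq_C_mul, derivative_mul]
      ring
    have e2 : X * (P (m + 1) * q) = P (m + 1) * (X * q) := by ring
    rw [e, map_add, map_sub, map_smul, star2, e2, oc m q hq,
      oc (m + 1) q (fun N hN => hq N (by omega)), oc (m + 1) (X * q),
      oc (m + 1) (X * (X * derivative q) - derivative q + C ((m : ℝ) + 1) * (X * q)
          + C ((m : ℝ) + 1 + 2 * r) * q)]
    · simp only [coeff_sub, coeff_add, coeff_C_mul]
      rw [coeff_X_mul, coeff_X_mul, coeff_X_mul_deriv, coeff_derivative,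
        hq (m + 1) (by omega), hq (m + 1 + 1) (by omega), ← hH, ← hK]
      simp only [smul_eq_mul]
      linear_combination (2 * R * q.coeff m) * hb + (H * q.coeff m) * hRv
    · intro N hN
      obtain ⟨k, rfl⟩ : ∃ k, N = k + 1 := ⟨N - 1, by omega⟩
      simp only [coeff_sub, coeff_add, coeff_C_mul]
      rw [coeff_X_mul, coeff_X_mul_deriv, coeff_derivative, coeff_X_mul,
        hq (k + 1) (by omega), hq (k + 1 + 1) (by omega), hq k (by omega)]
      ring
    · intro N hN
      obtain ⟨k, rfl⟩ : ∃ k, N = k + 1 := ⟨N - 1, by omega⟩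
      rw [coeff_X_mul, hq k (by omega)]
  by_contra hne
  exact (hpos D hne).ne' (LD D Dc)

/-- Raising ladder relation for monic Jacobi polynomials:
for every `n ≥ 1` and all real `z`,
`(z² - 1) Pₙ'(z) = [(n + rₙ)(z+1) - rₙ(z-1)] Pₙ(z) - 2 bₙ Rₙ P_{n-1}(z)`. -/
theorem jacobi_raising_ladder
    (α β : ℝ) (hα : 0 < α) (hβ : 0 < β)
    (P : ℕ → Polynomial ℝ)
    (hmonic : ∀ n, (P n).Monic) (hdeg : ∀ n, (P n).natDegree = n)
    (horth : ∀ m n : ℕ, m ≠ n →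
      ∫ x in (-1 : ℝ)..1, (P m).eval x * (P n).eval x * ((1 - x) ^ α * (1 + x) ^ β) = 0)
    (h : ℕ → ℝ)
    (hh : ∀ n, h n = ∫ x in (-1 : ℝ)..1, ((P n).eval x) ^ 2 * ((1 - x) ^ α * (1 + x) ^ β))
    (a b : ℕ → ℝ)
    (hrec : ∀ n : ℕ, 1 ≤ n → ∀ x : ℝ,
      x * (P n).eval x = (P (n + 1)).eval x + a n * (P n).eval x + b n * (P (n - 1)).eval x)
    (R r : ℕ → ℝ)
    (hR : ∀ n : ℕ, 1 ≤ n → R n =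
      (β / h n) * ∫ y in (-1 : ℝ)..1, ((P n).eval y) ^ 2 * ((1 - y) ^ α * (1 + y) ^ (β - 1)))
    (hr : ∀ n : ℕ, 1 ≤ n → r n =
      (β / h (n - 1)) * ∫ y in (-1 : ℝ)..1,
        (P n).eval y * (P (n - 1)).eval y * ((1 - y) ^ α * (1 + y) ^ (β - 1))) :
    ∀ n : ℕ, 1 ≤ n → ∀ z : ℝ,
      (z ^ 2 - 1) * ((Polynomial.derivative (P n)).eval z)
        = (((n : ℝ) + r n) * (z + 1) - r n * (z - 1)) * (P n).eval z
          - 2 * b n * R n * (P (n - 1)).eval z := by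
  intro n hn z
  obtain ⟨m, rfl⟩ : ∃ m, n = m + 1 := ⟨n - 1, by omega⟩
  set M := jacM α β hα hβ with hM
  set L : ℝ[X] →ₗ[ℝ] ℝ := M.comp (LinearMap.mulLeft ℝ (1 + X)) with hL
  have hLM : ∀ f, M ((1 + X) * f) = L f := fun f => rfl
  have hLi : ∀ f, L f = ∫ x in (-1 : ℝ)..1, f.eval x * ((1 - x) ^ α * (1 + x) ^ β) :=
    fun f => jacM_L α β hα hβ f
  have hMi : ∀ f, M f = ∫ x in (-1 : ℝ)..1, f.eval x * ((1 - x) ^ α * (1 + x) ^ (β - 1)) :=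
    fun f => rfl
  have hpos : ∀ f, f ≠ 0 → 0 < L (f * f) := by
    intro f hf
    have := jac_pos α β hα hβ f hf
    rw [hLi]
    simpa only [eval_mul, pow_two] using this
  have hhL : ∀ n, h n = L (P n * P n) := by
    intro n
    rw [hh, hLi]
    simp only [eval_mul, pow_two]
  have hne : ∀ n, h n ≠ 0 := fun n => by
    rw [hhL]
    exact (hpos _ (hmonic n).ne_zero).ne'
  have key := jac_alg α β L M hLM (jacM_ibp α β hα hβ) hpos P hmonic hdeg
    (fun i j hij => by
      rw [hLi]
      simpa only [eval_mul] using horth i j hij)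
    m (a (m + 1)) (b (m + 1)) (R (m + 1)) (r (m + 1))
    (by
      apply Polynomial.funext
      intro x
      have := hrec (m + 1) hn x
      simpa using this)
    (by
      have h0 := hne (m + 1)
      rw [← hhL, hR (m + 1) hn, hMi]
      simp only [eval_mul, pow_two]
      field_simp)
    (by
      have h0 := hne m
      rw [← hhL, hr (m + 1) hn, hMi]
      simp only [eval_mul, Nat.add_sub_cancel]
      field_simp)
  have key2 := congrArg (Polynomial.eval z) key
  simp only [eval_mul, eval_sub, eval_add, eval_pow, eval_X, eval_one, eval_C] at key2
  rw [key2, Nat.add_sub_cancel]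
  push_cast
  ring
end

section
/- For every n ≥ 1, 1 − aₙ = 2(rₙ − r_{n+1}). -/
open MeasureTheory Polynomial

lemma jac_cont (α β : ℝ) (hα : 0 < α) (hβ : 0 < β) (q : ℝ[X]) :
    IntervalIntegrable (fun x : ℝ => q.eval x * ((1 - x) ^ α * (1 + x) ^ β)) volume (-1) 1 := by
  apply Continuous.intervalIntegrable
  have h1 : Continuous fun x : ℝ => (1 - x) ^ α :=
    (continuous_const.sub continuous_id).rpow_const (fun _ => Or.inr hα.le)
  have h2 : Continuous fun x : ℝ => (1 + x) ^ β :=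
    (continuous_const.add continuous_id).rpow_const (fun _ => Or.inr hβ.le)
  exact q.continuous.mul (h1.mul h2)

lemma jac_int1 (α β : ℝ) (hα : 0 < α) (hβ : 0 < β) (q : ℝ[X]) :
    IntervalIntegrable (fun x : ℝ => q.eval x * ((1 - x) ^ α * (1 + x) ^ (β - 1)))
      volume (-1) 1 := by
  have h0 : IntervalIntegrable (fun x : ℝ => x ^ (β - 1)) volume 0 2 :=
    intervalIntegral.intervalIntegrable_rpow' (by linarith)
  have h3 : IntervalIntegrable (fun x : ℝ => (1 + x) ^ (β - 1)) volume (-1) 1 := by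
    have := h0.comp_add_left 1
    norm_num at this
    exact this
  have h1 : Continuous fun x : ℝ => (1 - x) ^ α :=
    (continuous_const.sub continuous_id).rpow_const (fun _ => Or.inr hα.le)
  have := h3.continuousOn_mul (q.continuous.mul h1).continuousOn
  refine this.congr ?_
  intro x _
  simp only [Pi.mul_apply, mul_assoc]

/-- Integration by parts. -/
lemma jac_ibp (α β : ℝ) (hα : 0 < α) (hβ : 0 < β) (p : ℝ[X]) :
    (∫ x in (-1 : ℝ)..1, (derivative p * (1 - X) - C (α + 1 + β) * p).eval x *
      ((1 - x) ^ α * (1 + x) ^ β)) +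
    2 * β * ∫ x in (-1 : ℝ)..1, p.eval x * ((1 - x) ^ α * (1 + x) ^ (β - 1)) = 0 := by
  have i1 := jac_cont α β hα hβ (derivative p * (1 - X) - C (α + 1 + β) * p)
  have i2 := (jac_int1 α β hα hβ p).const_mul (2 * β)
  rw [← intervalIntegral.integral_const_mul, ← intervalIntegral.integral_add i1 i2]
  have hc : Continuous fun x : ℝ => p.eval x * ((1 - x) ^ (α + 1) * (1 + x) ^ β) := by
    have h1 : Continuous fun x : ℝ => (1 - x) ^ (α + 1) :=
      (continuous_const.sub continuous_id).rpow_const (fun _ => Or.inr (by linarith))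
    have h2 : Continuous fun x : ℝ => (1 + x) ^ β :=
      (continuous_const.add continuous_id).rpow_const (fun _ => Or.inr hβ.le)
    exact p.continuous.mul (h1.mul h2)
  rw [intervalIntegral.integral_eq_sub_of_hasDerivAt_of_le (by norm_num) hc.continuousOn ?_
    (i1.add i2)]
  · have e1 : (1 - 1 : ℝ) ^ (α + 1) = 0 := by
      rw [sub_self]; exact Real.zero_rpow (by linarith)
    have e2 : (1 + -1 : ℝ) ^ β = 0 := by
      rw [add_neg_cancel]; exact Real.zero_rpow hβ.ne'
    rw [e1, e2]; ring
  · intro x hx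
    have hx1 : 0 < 1 - x := by linarith [hx.2]
    have hx2 : 0 < 1 + x := by linarith [hx.1]
    have d1 : HasDerivAt (fun x : ℝ => (1 - x) ^ (α + 1)) (-1 * (α + 1) * (1 - x) ^ (α + 1 - 1)) x :=
      ((hasDerivAt_id x).const_sub 1).rpow_const (Or.inl hx1.ne')
    have d2 : HasDerivAt (fun x : ℝ => (1 + x) ^ β) (1 * β * (1 + x) ^ (β - 1)) x :=
      ((hasDerivAt_id x).const_add 1).rpow_const (Or.inl hx2.ne')
    refine ((p.hasDerivAt x).mul (d1.mul d2)).congr_deriv ?_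
    have e1 : (1 - x) ^ (α + 1) = (1 - x) ^ α * (1 - x) := Real.rpow_add_one hx1.ne' α
    have e2 : (1 + x) ^ β = (1 + x) ^ (β - 1) * (1 + x) := by
      rw [← Real.rpow_add_one hx2.ne']; simp
    simp only [eval_sub, eval_mul, eval_C, eval_X, eval_one, Pi.mul_apply, add_sub_cancel_right]
    rw [e1, e2]; ring

/-- The weighted integral as a linear functional. -/
noncomputable def jacL (α β : ℝ) (hα : 0 < α) (hβ : 0 < β) : ℝ[X] →ₗ[ℝ] ℝ where
  toFun q := ∫ x in (-1 : ℝ)..1, q.eval x * ((1 - x) ^ α * (1 + x) ^ β)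
  map_add' p q := by
    rw [← intervalIntegral.integral_add (jac_cont α β hα hβ p) (jac_cont α β hα hβ q)]
    simp only [eval_add, add_mul]
  map_smul' c q := by
    simp only [eval_smul, smul_eq_mul, RingHom.id_apply, mul_assoc]
    rw [intervalIntegral.integral_const_mul]

lemma jacL_pos (α β : ℝ) (hα : 0 < α) (hβ : 0 < β) (q : ℝ[X]) (hq : q ≠ 0) :
    0 < jacL α β hα hβ (q * q) := by
  change 0 < ∫ x in (-1 : ℝ)..1, (q * q).eval x * ((1 - x) ^ α * (1 + x) ^ β)
  have hfin : (q.roots.toFinset : Set ℝ).Finite := Finset.finite_toSet _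
  obtain ⟨c, hc, hcr⟩ : ∃ c ∈ Set.Ioo (-1 : ℝ) 1, c ∉ (q.roots.toFinset : Set ℝ) :=
    (Set.Ioo_infinite (by norm_num : (-1 : ℝ) < 1)).exists_notMem_finite hfin
  have hqc : q.eval c ≠ 0 := by
    intro h; apply hcr; simp [hq, h]
  have h1 : Continuous fun x : ℝ => (1 - x) ^ α :=
    (continuous_const.sub continuous_id).rpow_const (fun _ => Or.inr hα.le)
  have h2 : Continuous fun x : ℝ => (1 + x) ^ β :=
    (continuous_const.add continuous_id).rpow_const (fun _ => Or.inr hβ.le)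
  refine intervalIntegral.integral_pos (by norm_num)
    ((q * q).continuous.mul (h1.mul h2)).continuousOn ?_ ⟨c, ⟨hc.1.le, hc.2.le⟩, ?_⟩
  · intro x hx
    rw [eval_mul]
    exact mul_nonneg (mul_self_nonneg _) (mul_nonneg (Real.rpow_nonneg (by linarith [hx.2]) _)
      (Real.rpow_nonneg (by linarith [hx.1]) _))
  · rw [eval_mul]
    exact mul_pos (mul_self_pos.2 hqc) (mul_pos (Real.rpow_pos_of_pos (by linarith [hc.2]) _)
      (Real.rpow_pos_of_pos (by linarith [hc.1]) _))

lemma jac_deg_step (P : ℕ → ℝ[X])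
    (hmonic : ∀ n, (P n).Monic) (hdeg : ∀ n, (P n).natDegree = n) (k : ℕ) (q : ℝ[X])
    (hq : q.degree < (k + 1 : ℕ)) : (q - C (q.coeff k) * P k).degree < (k : ℕ) := by
  rw [degree_lt_iff_coeff_zero] at hq ⊢
  intro m hm
  have hPk : (P k).coeff k = 1 := by
    have := (hmonic k).coeff_natDegree
    rwa [hdeg k] at this
  rcases hm.eq_or_lt with rfl | hlt
  · simp [hPk]
  · rw [coeff_sub, coeff_C_mul, hq m hlt,
      coeff_eq_zero_of_natDegree_lt (p := P k) (by rw [hdeg k]; exact hlt)]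
    simp

lemma jac_orth (L : ℝ[X] →ₗ[ℝ] ℝ) (P : ℕ → ℝ[X])
    (hmonic : ∀ n, (P n).Monic) (hdeg : ∀ n, (P n).natDegree = n)
    (ho : ∀ m n, m ≠ n → L (P m * P n) = 0) (n : ℕ) :
    ∀ k ≤ n, ∀ q : ℝ[X], q.degree < (k : ℕ) → L (q * P n) = 0 := by
  intro k
  induction k with
  | zero =>
    intro _ q hq
    have : q = 0 := by
      rw [← degree_eq_bot]; simpa using hq
    simp [this]
  | succ k ih =>
    intro hk q hq
    have h1 := ih (by omega) _ (jac_deg_step P hmonic hdeg k q hq)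
    rw [sub_mul, map_sub, mul_assoc, C_mul', map_smul, ho k n (by omega)] at h1
    simpa using h1

lemma jac_coeff (L : ℝ[X] →ₗ[ℝ] ℝ) (P : ℕ → ℝ[X])
    (hmonic : ∀ n, (P n).Monic) (hdeg : ∀ n, (P n).natDegree = n)
    (ho : ∀ m n, m ≠ n → L (P m * P n) = 0) (n : ℕ) (q : ℝ[X])
    (hq : q.degree < (n + 1 : ℕ)) : L (q * P n) = q.coeff n * L (P n * P n) := by
  have h1 := jac_orth L P hmonic hdeg ho n n le_rfl _ (jac_deg_step P hmonic hdeg n q hq)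
  rw [sub_mul, map_sub, mul_assoc, C_mul', map_smul, smul_eq_mul] at h1
  linarith

lemma jac_coeff_aux (q : ℝ[X]) (m : ℕ) :
    (derivative q * (1 - X)).coeff m = q.coeff (m + 1) * (m + 1) - m * q.coeff m := by
  rw [mul_sub, mul_one, coeff_sub, coeff_derivative]
  cases m with
  | zero => simp
  | succ k => rw [coeff_mul_X, coeff_derivative]; push_cast; ring

lemma jac_main (L : ℝ[X] →ₗ[ℝ] ℝ) (P : ℕ → ℝ[X])
    (hmonic : ∀ n, (P n).Monic) (hdeg : ∀ n, (P n).natDegree = n)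
    (ho : ∀ m n, m ≠ n → L (P m * P n) = 0) (m : ℕ) (c : ℝ) :
    L (derivative (P (m + 1) * P m) * (1 - X) - C c * (P (m + 1) * P m)) =
      (m + 1 + (P (m + 1)).coeff m) * L (P m * P m) := by
  have hlead : ∀ k, (P k).coeff k = 1 := fun k => by
    have := (hmonic k).coeff_natDegree
    rwa [hdeg k] at this
  have hz : ∀ k j, k < j → (P k).coeff j = 0 := fun k j hj =>
    coeff_eq_zero_of_natDegree_lt (by rw [hdeg k]; exact hj)
  have e : derivative (P (m + 1) * P m) * (1 - X) - C c * (P (m + 1) * P m) =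
      (derivative (P (m + 1)) * (1 - X) + C ((m : ℝ) + 1) * P (m + 1)) * P m
      + (derivative (P m) * (1 - X)) * P (m + 1)
      - C (c + (m + 1)) * (P (m + 1) * P m) := by
    rw [derivative_mul]; simp only [C_add]; ring
  have h1 : L ((derivative (P (m + 1)) * (1 - X) + C ((m : ℝ) + 1) * P (m + 1)) * P m) =
      (m + 1 + (P (m + 1)).coeff m) * L (P m * P m) := by
    rw [jac_coeff L P hmonic hdeg ho m]
    · rw [coeff_add, jac_coeff_aux, coeff_C_mul, hlead]; ring
    · rw [degree_lt_iff_coeff_zero]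
      intro j hj
      rw [coeff_add, jac_coeff_aux, coeff_C_mul, hz (m + 1) (j + 1) (by omega)]
      rcases hj.eq_or_lt with rfl | hlt
      · push_cast; ring
      · rw [hz (m + 1) j hlt]; ring
  have h2 : L ((derivative (P m) * (1 - X)) * P (m + 1)) = 0 := by
    refine jac_orth L P hmonic hdeg ho (m + 1) (m + 1) le_rfl _ ?_
    rw [degree_lt_iff_coeff_zero]
    intro j hj
    rw [jac_coeff_aux, hz m (j + 1) (by omega), hz m j (by omega)]; ring
  rw [e, map_sub, map_add, h1, h2, C_mul', map_smul, ho (m + 1) m (by omega)]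
  simp

/-- for every `n ≥ 1`, `1 - aₙ = 2(rₙ - r_{n+1})`. -/
theorem jacobi_one_sub_an
    (α β : ℝ) (hα : 0 < α) (hβ : 0 < β)
    (P : ℕ → Polynomial ℝ)
    (hmonic : ∀ n, (P n).Monic) (hdeg : ∀ n, (P n).natDegree = n)
    (horth : ∀ m n : ℕ, m ≠ n →
      ∫ x in (-1 : ℝ)..1, (P m).eval x * (P n).eval x * ((1 - x) ^ α * (1 + x) ^ β) = 0)
    (h : ℕ → ℝ)
    (hh : ∀ n, h n = ∫ x in (-1 : ℝ)..1, ((P n).eval x) ^ 2 * ((1 - x) ^ α * (1 + x) ^ β))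
    (a b : ℕ → ℝ)
    (hrec : ∀ n : ℕ, 1 ≤ n → ∀ x : ℝ,
      x * (P n).eval x = (P (n + 1)).eval x + a n * (P n).eval x + b n * (P (n - 1)).eval x)
    (r : ℕ → ℝ)
    (hr : ∀ n : ℕ, 1 ≤ n → r n =
      (β / h (n - 1)) * ∫ y in (-1 : ℝ)..1,
        (P n).eval y * (P (n - 1)).eval y * ((1 - y) ^ α * (1 + y) ^ (β - 1))) :
    ∀ n : ℕ, 1 ≤ n → 1 - a n = 2 * (r n - r (n + 1)) := by
  have ho : ∀ m n, m ≠ n → jacL α β hα hβ (P m * P n) = 0 := by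
    intro m n hmn
    have := horth m n hmn
    simp only [← eval_mul] at this
    exact this
  have hL : ∀ n, h n = jacL α β hα hβ (P n * P n) := by
    intro n
    rw [hh n]
    simp only [sq, ← eval_mul]
    rfl
  have key : ∀ m : ℕ, 2 * r (m + 1) = -(m + 1 + (P (m + 1)).coeff m) := by
    intro m
    have hpos : 0 < h m := by
      rw [hL m]; exact jacL_pos α β hα hβ _ (hmonic m).ne_zero
    have h1 := jac_ibp α β hα hβ (P (m + 1) * P m)
    have h2 := jac_main (jacL α β hα hβ) P hmonic hdeg ho m (α + 1 + β)
    rw [← hL m] at h2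
    have h3 := hr (m + 1) (by omega)
    simp only [add_tsub_cancel_right, ← eval_mul] at h3
    change (jacL α β hα hβ _) + _ = 0 at h1
    rw [h2] at h1
    generalize (∫ x in (-1 : ℝ)..1, (P (m + 1) * P m).eval x *
      ((1 - x) ^ α * (1 + x) ^ (β - 1))) = J at h1 h3
    rw [h3]
    field_simp
    linarith
  intro n hn
  obtain ⟨m, rfl⟩ : ∃ m, n = m + 1 := ⟨n - 1, by omega⟩
  have k1 := key m
  have k2 := key (m + 1)
  have hpoly : X * P (m + 1) = P (m + 1 + 1) + C (a (m + 1)) * P (m + 1)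
      + C (b (m + 1)) * P m := by
    apply Polynomial.funext
    intro x
    have := hrec (m + 1) hn x
    simpa using this
  have hco := congrArg (fun q => q.coeff (m + 1)) hpoly
  have hlead : (P (m + 1)).coeff (m + 1) = 1 := by
    have := (hmonic (m + 1)).coeff_natDegree
    rwa [hdeg (m + 1)] at this
  have hz : (P m).coeff (m + 1) = 0 :=
    coeff_eq_zero_of_natDegree_lt (by rw [hdeg m]; omega)
  simp only [coeff_X_mul, coeff_add, coeff_C_mul, hlead, hz] at hco
  push_cast at k2
  linarith
end

section
/- (Boundary relations from regularity of Pₙ′ at z = ±1.) For every n ≥ 1: (n + rₙ) Pₙ(1) = bₙ Rₙ P_{n−1}(1), and bₙ Rₙ P_{n−1}(−1) = rₙ Pₙ(−1). -/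
open MeasureTheory Polynomial

theorem jb_int (w : ℝ → ℝ) (hw : IntervalIntegrable w volume (-1) 1) (q : ℝ[X]) :
    IntervalIntegrable (fun x => q.eval x * w x) volume (-1) 1 :=
  hw.continuousOn_mul q.continuous.continuousOn

/-- The functional `q ↦ ∫ q w`. -/
noncomputable def jbL (w : ℝ → ℝ) (hw : IntervalIntegrable w volume (-1) 1) : ℝ[X] →ₗ[ℝ] ℝ where
  toFun q := ∫ x in (-1 : ℝ)..1, q.eval x * w x
  map_add' p q := by
    rw [← intervalIntegral.integral_add (jb_int w hw p) (jb_int w hw q)]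
    congr 1; ext x; simp [add_mul]
  map_smul' c q := by
    simp only [RingHom.id_apply, smul_eq_mul]
    rw [← intervalIntegral.integral_const_mul]
    congr 1; ext x; simp [mul_assoc]

theorem jbL_apply (w : ℝ → ℝ) (hw) (q : ℝ[X]) :
    jbL w hw q = ∫ x in (-1 : ℝ)..1, q.eval x * w x := rfl

theorem jbL_C (w : ℝ → ℝ) (hw) (c : ℝ) (q : ℝ[X]) :
    jbL w hw (C c * q) = c * jbL w hw q := by
  rw [← smul_eq_C_mul, map_smul, smul_eq_mul]

theorem jb_v_int (α β : ℝ) (hα : 0 < α) (hβ : 0 < β) :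
    IntervalIntegrable (fun x : ℝ => (1 - x) ^ α * (1 + x) ^ (β - 1)) volume (-1) 1 := by
  have h1 : IntervalIntegrable (fun x : ℝ => (1 + x) ^ (β - 1)) volume (-1) 1 := by
    have := (intervalIntegral.intervalIntegrable_rpow' (a := 0) (b := 2) (r := β - 1)
      (by linarith)).comp_add_left 1
    norm_num at this
    exact this
  refine h1.continuousOn_mul (Continuous.continuousOn ?_)
  exact (continuous_const.sub continuous_id).rpow_const (fun _ => Or.inr hα.le)

theorem jb_w_cont (α β : ℝ) (hα : 0 < α) (hβ : 0 < β) :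
    Continuous (fun x : ℝ => (1 - x) ^ α * (1 + x) ^ β) :=
  ((continuous_const.sub continuous_id).rpow_const (fun _ => Or.inr hα.le)).mul
    ((continuous_const.add continuous_id).rpow_const (fun _ => Or.inr hβ.le))

theorem jb_ibp (α β : ℝ) (hα : 0 < α) (hβ : 0 < β) (hw) (hv) (f : ℝ[X]) :
    β * jbL (fun x : ℝ => (1 - x) ^ α * (1 + x) ^ (β - 1)) hv ((1 - X) * f)
      + jbL (fun x : ℝ => (1 - x) ^ α * (1 + x) ^ β) hw ((1 - X) * derivative f)
      - (α + 1) * jbL (fun x : ℝ => (1 - x) ^ α * (1 + x) ^ β) hw f = 0 := by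
  have i1 := (jb_int _ hv ((1 - X) * f)).const_mul β
  have i2 := jb_int _ hw ((1 - X) * derivative f)
  have i3 := (jb_int _ hw f).const_mul (α + 1)
  have key := intervalIntegral.integral_eq_sub_of_hasDerivAt_of_le (a := -1) (b := 1)
    (f := fun x : ℝ => f.eval x * ((1 - x) ^ (α + 1) * (1 + x) ^ β)) (by norm_num)
    (Continuous.continuousOn (f.continuous.mul (jb_w_cont (α + 1) β (by linarith) hβ)))
    (f' := fun x => β * (((1 - X) * f).eval x * ((1 - x) ^ α * (1 + x) ^ (β - 1)))
      + ((1 - X) * derivative f).eval x * ((1 - x) ^ α * (1 + x) ^ β)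
      - (α + 1) * (f.eval x * ((1 - x) ^ α * (1 + x) ^ β)))
    (by
      intro x hx
      have hx1 : 0 < 1 - x := by linarith [hx.2]
      have hx2 : 0 < 1 + x := by linarith [hx.1]
      have d1 := ((hasDerivAt_id x).const_sub 1).rpow_const (p := α + 1) (Or.inl hx1.ne')
      have d2 := ((hasDerivAt_id x).const_add 1).rpow_const (p := β) (Or.inl hx2.ne')
      have d := (f.hasDerivAt x).mul (d1.mul d2)
      refine d.congr_deriv ?_
      simp only [id, eval_mul, eval_sub, eval_one, eval_X, Pi.mul_apply, add_sub_cancel_right]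
      rw [Real.rpow_add_one hx1.ne']
      ring)
    ((i1.add i2).sub i3)
  rw [intervalIntegral.integral_sub (i1.add i2) i3, intervalIntegral.integral_add i1 i2,
    intervalIntegral.integral_const_mul, intervalIntegral.integral_const_mul] at key
  simp only [jbL_apply]
  rw [key]
  norm_num [Real.zero_rpow hβ.ne', Real.zero_rpow (by linarith : α + 1 ≠ 0)]

theorem jb_vw (α β : ℝ) (hw) (hv) (f : ℝ[X]) :
    jbL (fun x : ℝ => (1 - x) ^ α * (1 + x) ^ (β - 1)) hv ((X - C (-1)) * f) =
      jbL (fun x : ℝ => (1 - x) ^ α * (1 + x) ^ β) hw f := by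
  simp only [jbL_apply]
  refine intervalIntegral.integral_congr_ae (Filter.Eventually.of_forall ?_)
  intro x hx
  rw [Set.uIoc_of_le (by norm_num)] at hx
  have hx2 : 0 < 1 + x := by linarith [hx.1]
  have : (1 + x) ^ β = (1 + x) ^ (β - 1) * (1 + x) := by
    rw [← Real.rpow_add_one hx2.ne']; simp
  rw [this]
  simp
  ring

theorem jb_orth (L : ℝ[X] →ₗ[ℝ] ℝ) (P : ℕ → ℝ[X]) (hmonic : ∀ n, (P n).Monic)
    (hdeg : ∀ n, (P n).natDegree = n) (ho : ∀ m n, m ≠ n → L (P m * P n) = 0) (n : ℕ) :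
    ∀ d ≤ n, ∀ q : ℝ[X], q.degree < d → L (P n * q) = 0 := by
  intro d
  induction d with
  | zero =>
    intro _ q hq
    have : q = 0 := by simpa using hq
    simp [this]
  | succ d ih =>
    intro hd q hq
    have h1 := ih (by omega) (q - C (q.coeff d) * P d) (by
      rw [degree_lt_iff_coeff_zero] at hq ⊢
      intro m hm
      rw [coeff_sub, coeff_C_mul]
      rcases hm.eq_or_lt with rfl | hm
      · have := (hmonic d).coeff_natDegree
        rw [hdeg] at this
        simp [this]
      · rw [hq m hm, coeff_eq_zero_of_natDegree_lt (p := P d) (by rw [hdeg]; exact hm)]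
        simp)
    have h2 : P n * q = P n * (q - C (q.coeff d) * P d) + q.coeff d • (P n * P d) := by
      rw [smul_eq_C_mul]; ring
    rw [h2, map_add, h1, map_smul, ho n d (by omega)]
    simp

/-- Division of a polynomial of degree at most `n` by a linear factor. -/
theorem jb_div (n : ℕ) (c : ℝ) (D : ℝ[X]) (hD : D.natDegree ≤ n) (hc : D.eval c = 0)
    (hn : 1 ≤ n) : ∃ q : ℝ[X], D = (X - C c) * q ∧ q.degree < n := by
  obtain ⟨q, hq⟩ := dvd_iff_isRoot.mpr hc
  refine ⟨q, hq, ?_⟩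
  by_cases h0 : q = 0
  · simp [h0]
  · rw [hq, natDegree_mul (X_sub_C_ne_zero c) h0, natDegree_X_sub_C] at hD
    rw [degree_eq_natDegree h0]
    exact_mod_cast (by omega : q.natDegree < n)

theorem jb_pos (w : ℝ → ℝ) (hc : Continuous w) (hpos : ∀ x ∈ Set.Ioo (-1 : ℝ) 1, 0 < w x)
    (hnn : ∀ x ∈ Set.Icc (-1 : ℝ) 1, 0 ≤ w x)
    (p : ℝ[X]) (hp : p ≠ 0) : 0 < ∫ x in (-1 : ℝ)..1, (p.eval x) ^ 2 * w x := by
  obtain ⟨c, hc1, hc2⟩ : ∃ c ∈ Set.Ioo (-1 : ℝ) 1, p.eval c ≠ 0 := by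
    by_contra! hcon
    apply hp
    refine eq_zero_of_infinite_isRoot p ((Set.Ioo_infinite (by norm_num : (-1 : ℝ) < 1)).mono ?_)
    intro x hx
    exact hcon x hx
  refine intervalIntegral.integral_pos (by norm_num) ((p.continuous.pow 2).mul hc).continuousOn
    ?_ ⟨c, Set.Ioo_subset_Icc_self hc1, ?_⟩
  · intro x hx
    exact mul_nonneg (sq_nonneg _) (hnn x (Set.Ioc_subset_Icc_self hx))
  · have := hpos c hc1
    positivity

/-- Boundary relations from regularity of `Pₙ'` at `z = ±1`:
for every `n ≥ 1`, `(n + rₙ) Pₙ(1) = bₙ Rₙ P_{n-1}(1)` and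
`bₙ Rₙ P_{n-1}(-1) = rₙ Pₙ(-1)`. -/
theorem jacobi_boundary_relations
    (α β : ℝ) (hα : 0 < α) (hβ : 0 < β)
    (P : ℕ → Polynomial ℝ)
    (hmonic : ∀ n, (P n).Monic) (hdeg : ∀ n, (P n).natDegree = n)
    (horth : ∀ m n : ℕ, m ≠ n →
      ∫ x in (-1 : ℝ)..1, (P m).eval x * (P n).eval x * ((1 - x) ^ α * (1 + x) ^ β) = 0)
    (h : ℕ → ℝ)
    (hh : ∀ n, h n = ∫ x in (-1 : ℝ)..1, ((P n).eval x) ^ 2 * ((1 - x) ^ α * (1 + x) ^ β))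
    (a b : ℕ → ℝ)
    (hrec : ∀ n : ℕ, 1 ≤ n → ∀ x : ℝ,
      x * (P n).eval x = (P (n + 1)).eval x + a n * (P n).eval x + b n * (P (n - 1)).eval x)
    (R r : ℕ → ℝ)
    (hR : ∀ n : ℕ, 1 ≤ n → R n =
      (β / h n) * ∫ y in (-1 : ℝ)..1, ((P n).eval y) ^ 2 * ((1 - y) ^ α * (1 + y) ^ (β - 1)))
    (hr : ∀ n : ℕ, 1 ≤ n → r n =
      (β / h (n - 1)) * ∫ y in (-1 : ℝ)..1,
        (P n).eval y * (P (n - 1)).eval y * ((1 - y) ^ α * (1 + y) ^ (β - 1))) :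
    ∀ n : ℕ, 1 ≤ n →
      (((n : ℝ) + r n) * (P n).eval 1 = b n * R n * (P (n - 1)).eval 1)
      ∧ (b n * R n * (P (n - 1)).eval (-1) = r n * (P n).eval (-1)) := by
  intro n hn
  obtain ⟨k, rfl⟩ : ∃ k, n = k + 1 := ⟨n - 1, by omega⟩
  have hv := jb_v_int α β hα hβ
  have hwc := jb_w_cont α β hα hβ
  have hw : IntervalIntegrable (fun x : ℝ => (1 - x) ^ α * (1 + x) ^ β) volume (-1) 1 :=
    hwc.intervalIntegrable _ _
  have hibp := jb_ibp α β hα hβ hw hv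
  have hvw := jb_vw α β hw hv
  have hLw := jbL_apply _ hw
  have hLv := jbL_apply _ hv
  have hCw := jbL_C _ hw
  have hCv := jbL_C _ hv
  have hpos : ∀ m, 0 < h m := by
    intro m
    rw [hh]
    refine jb_pos _ hwc ?_ ?_ _ (hmonic m).ne_zero
    · intro x hx
      have hx1 : 0 < 1 - x := by linarith [hx.2]
      have hx2 : 0 < 1 + x := by linarith [hx.1]
      positivity
    · intro x hx
      have hx1 : 0 ≤ 1 - x := by linarith [hx.2]
      have hx2 : 0 ≤ 1 + x := by linarith [hx.1]
      positivity
  generalize jbL _ hw = L at *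
  generalize jbL _ hv = V at *
  have ho : ∀ m n, m ≠ n → L (P m * P n) = 0 := by
    intro m n hmn
    rw [hLw, ← horth m n hmn]
    simp only [eval_mul]
  have hhL : ∀ m, h m = L (P m * P m) := by
    intro m
    rw [hh, hLw]
    simp only [eval_mul, pow_two]
  have hI : R (k + 1) = β / h (k + 1) * V (P (k + 1) * P (k + 1)) := by
    rw [hR _ hn, hLv]
    simp only [eval_mul, pow_two]
  have hJ : r (k + 1) = β / h k * V (P (k + 1) * P k) := by
    rw [hr _ hn, hLv]
    simp only [eval_mul, Nat.add_sub_cancel]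
  have orth : ∀ (m : ℕ) (q : ℝ[X]), q.degree < m → L (P m * q) = 0 :=
    fun m => jb_orth L P hmonic hdeg ho m m le_rfl
  have c1 : ∀ m, (P m).coeff m = 1 := by
    intro m
    have := (hmonic m).coeff_natDegree
    rwa [hdeg] at this
  have c0 : ∀ m l, m < l → (P m).coeff l = 0 := fun m l hl =>
    coeff_eq_zero_of_natDegree_lt (by rw [hdeg]; exact hl)
  have hb : b (k + 1) * h k = h (k + 1) := by
    have e : X * P (k + 1) = P (k + 1 + 1) + C (a (k + 1)) * P (k + 1) + C (b (k + 1)) * P k := by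
      apply Polynomial.funext
      intro x
      simpa using hrec (k + 1) hn x
    have e1 : L (P (k + 1) * (X * P k - P (k + 1))) = 0 := by
      apply orth
      rw [degree_lt_iff_coeff_zero]
      intro m hm
      obtain ⟨m, rfl⟩ : ∃ l, m = l + 1 := ⟨m - 1, by omega⟩
      rw [coeff_sub, coeff_X_mul]
      rcases hm.eq_or_lt with hm | hm
      · have : m = k := by omega
        subst this
        rw [c1, c1, sub_self]
      · rw [c0 _ _ (by omega), c0 _ _ (by omega), sub_self]
    have e2 : P (k + 1) * (X * P k - P (k + 1)) = P (k + 1 + 1) * P k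
        + C (a (k + 1)) * (P (k + 1) * P k) + C (b (k + 1)) * (P k * P k)
        - P (k + 1) * P (k + 1) := by
      linear_combination P k * e
    rw [e2, map_sub, map_add, map_add, hCw, hCw, ho _ _ (by omega), ho _ _ (by omega),
      ← hhL, ← hhL] at e1
    linarith
  have hk := (hpos k).ne'
  have hk1 := (hpos (k + 1)).ne'
  have hbR : b (k + 1) * R (k + 1) = β / h k * V (P (k + 1) * P (k + 1)) := by
    have : b (k + 1) = h (k + 1) / h k := by field_simp; exact hb
    rw [this, hI]
    field_simp
  simp only [Nat.add_sub_cancel]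
  rw [hbR, hJ]
  have hDdeg : ∀ s t : ℝ, (C s * P k - C t * P (k + 1)).natDegree ≤ k + 1 := by
    intro s t
    refine (natDegree_sub_le _ _).trans (max_le ?_ ?_)
    · exact (natDegree_C_mul_le _ _).trans (by rw [hdeg]; omega)
    · exact (natDegree_C_mul_le _ _).trans (by rw [hdeg])
  constructor
  · obtain ⟨q, hq, hqd⟩ := jb_div (k + 1) 1
      (C ((P (k + 1)).eval 1) * P k - C ((P k).eval 1) * P (k + 1)) (hDdeg _ _)
      (by simp; ring) hn
    have hi := hibp (P (k + 1) * q)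
    rw [C_1] at hq
    have o1 := orth _ q hqd
    have o2 : L (P (k + 1) * ((1 - X) * derivative q)) = 0 := by
      apply orth
      rw [degree_lt_iff_coeff_zero] at hqd ⊢
      intro m hm
      obtain ⟨m, rfl⟩ : ∃ l, m = l + 1 := ⟨m - 1, by omega⟩
      rw [sub_mul, one_mul, coeff_sub, coeff_X_mul, coeff_derivative, coeff_derivative,
        hqd _ (by omega), hqd _ (by omega)]
      simp
    have o3 : L (P (k + 1) * derivative (P (k + 1))) = 0 := by
      apply orth
      rw [degree_lt_iff_coeff_zero]
      intro m hm
      rw [coeff_derivative, c0 _ _ (by omega), zero_mul]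
    have o4 : L (P k * (derivative (P (k + 1)) - C ((k : ℝ) + 1) * P k)) = 0 := by
      apply orth
      rw [degree_lt_iff_coeff_zero]
      intro m hm
      rw [coeff_sub, coeff_C_mul, coeff_derivative]
      rcases hm.eq_or_lt with hm | hm
      · subst hm
        rw [c1, c1]; ring
      · rw [c0 _ _ (by omega), c0 _ _ (by omega)]; ring
    have o5 : L (P k * derivative (P (k + 1))) = (k + 1) * h k := by
      rw [hhL, ← hCw, ← sub_eq_zero, ← map_sub, ← o4]
      congr 1; ring
    have e1 : (1 - X) * (P (k + 1) * q) = C ((P k).eval 1) * (P (k + 1) * P (k + 1))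
        - C ((P (k + 1)).eval 1) * (P (k + 1) * P k) := by
      linear_combination (P (k + 1)) * hq
    have e2 : (1 - X) * derivative (P (k + 1) * q) =
        C ((P k).eval 1) * (P (k + 1) * derivative (P (k + 1)))
        - C ((P (k + 1)).eval 1) * (P k * derivative (P (k + 1)))
        + P (k + 1) * ((1 - X) * derivative q) := by
      rw [derivative_mul]
      linear_combination (derivative (P (k + 1))) * hq
    rw [e1, e2, o1, map_sub, map_add, map_sub, hCv, hCv, hCw, hCw, o2, o3, o5] at hi
    field_simp
    push_cast
    linarith
  · obtain ⟨q, hq, hqd⟩ := jb_div (k + 1) (-1)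
      (C ((P (k + 1)).eval (-1)) * P k - C ((P k).eval (-1)) * P (k + 1)) (hDdeg _ _)
      (by simp; ring) hn
    have o1 := orth _ q hqd
    rw [← hvw] at o1
    have e1 : (X - C (-1)) * (P (k + 1) * q) = C ((P (k + 1)).eval (-1)) * (P (k + 1) * P k)
        - C ((P k).eval (-1)) * (P (k + 1) * P (k + 1)) := by
      linear_combination (-P (k + 1)) * hq
    rw [e1, map_sub, hCv, hCv] at o1
    linear_combination (-(β / h k)) * o1
end
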